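/- arXiv:1005.5359 — 3 statements merged into one kernel-verified Lean document; each statement's English description precedes it below -/
import Mathlib

section
/- Let S be a 2-dimensional complete regular local ring, f = f_1 ⋯ f_n a product of pairwise non-associate primes, R = S/(f). Let I, J be disjoint subsets of {1,…,n}, N a maximal Cohen-Macaulay S_I-module, and M the first R-syzygy of N. Then Ext_R^1(M, S_J) = 0. -/
open CategoryTheory Opposite IsLocalRing

noncomputable abbrev ExtGroup (R : Type) [CommRing R] (i : ℕ)
    (M N : Type) [AddCommGroup M] [Module R M] [AddCommGroup N] [Module R N] : Type :=
  ((Ext R (ModuleCat R) i).obj (op (ModuleCat.of R M))).obj (ModuleCat.of R N)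

noncomputable def moduleDepth (R : Type) [CommRing R] [IsLocalRing R]
    (M : Type) [AddCommGroup M] [Module R M] : ℕ∞ :=
  sInf {i : ℕ∞ | ∃ n : ℕ, i = n ∧ Nontrivial (ExtGroup R n (ResidueField R) M)}

def IsRegularLocalTwoDim (S : Type) [CommRing S] [IsLocalRing S] : Prop :=
  IsNoetherianRing S ∧ ringKrullDim S = 2 ∧
    ∃ x y : S, IsLocalRing.maximalIdeal S = Ideal.span {x, y}

lemma reg_span_prime {S : Type} [CommRing S] [IsLocalRing S] [IsNoetherianRing S]
    (hdim : ringKrullDim S = 2) (x y : S) (h : maximalIdeal S = Ideal.span {x, y}) :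
    (Ideal.span {x}).IsPrime ∧ y ∉ Ideal.span {x} := by
  have hx : x ∈ maximalIdeal S := by rw [h]; exact Ideal.subset_span (by simp)
  have hex : ∃ P : Ideal S, P.IsPrime ∧ x ∈ P ∧ P ≠ maximalIdeal S := by
    by_contra! hc
    have hmem : maximalIdeal S ∈ (Ideal.span {x}).minimalPrimes := by
      refine ⟨⟨inferInstance, by simpa [Ideal.span_le] using hx⟩, ?_⟩
      rintro Q ⟨hQ, hxQ⟩ -
      rw [hc Q hQ (hxQ (Ideal.mem_span_singleton_self x))]
    have h1 := Ideal.height_le_one_of_isPrincipal_of_mem_minimalPrimes _ _ hmem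
    have h2 := IsLocalRing.maximalIdeal_height_eq_ringKrullDim (R := S)
    rw [hdim] at h2
    have h3 : (maximalIdeal S).height = 2 := WithBot.coe_injective h2
    rw [h3] at h1
    exact absurd h1 (by decide)
  obtain ⟨P, hP, hxP, hPm⟩ := hex
  have hyP : y ∉ P := by
    intro hy
    refine hPm (le_antisymm (le_maximalIdeal hP.ne_top) ?_)
    rw [h, Ideal.span_le]
    rintro z (rfl | rfl) <;> assumption
  have hle : P ≤ Ideal.span {x} := by
    refine Submodule.le_of_le_smul_of_le_jacobson_bot (I := maximalIdeal S)
      (IsNoetherian.noetherian P) ?_ ?_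
    · rw [IsLocalRing.jacobson_eq_maximalIdeal ⊥ bot_ne_top]
    · intro p hp
      have : p ∈ Ideal.span {x, y} := h ▸ le_maximalIdeal hP.ne_top hp
      obtain ⟨a, b, rfl⟩ := Ideal.mem_span_pair.1 this
      have hb : b ∈ P := by
        have : b * y ∈ P := by simpa using P.sub_mem hp (P.mul_mem_left a hxP)
        exact (hP.mem_or_mem this).resolve_right hyP
      refine Submodule.add_mem_sup (Ideal.mul_mem_left _ _ (Ideal.mem_span_singleton_self x)) ?_
      rw [mul_comm]
      exact Submodule.smul_mem_smul (h ▸ Ideal.subset_span (by simp)) hb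
  have heq : P = Ideal.span {x} := le_antisymm hle (by simpa [Ideal.span_le] using hxP)
  subst heq
  exact ⟨hP, hyP⟩

lemma reg_isDomain {S : Type} [CommRing S] [IsLocalRing S] [IsNoetherianRing S]
    (hdim : ringKrullDim S = 2) (x y : S) (h : maximalIdeal S = Ideal.span {x, y}) :
    IsDomain S := by
  have hspan (k : ℕ) : maximalIdeal S = Ideal.span {x + y ^ (k + 1), y} := by
    rw [h]
    apply le_antisymm <;> rw [Ideal.span_le]
    · rintro z (rfl | rfl)
      · exact Ideal.mem_span_pair.2 ⟨1, - y ^ k, by ring⟩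
      · exact Ideal.subset_span (by simp)
    · rintro z (rfl | rfl)
      · exact Ideal.mem_span_pair.2 ⟨1, y ^ k, by ring⟩
      · exact Ideal.subset_span (by simp)
  have hp (k : ℕ) := reg_span_prime hdim _ _ (hspan k)
  have hinj : Function.Injective (fun k : ℕ => Ideal.span {x + y ^ (k + 1)}) := by
    have key : ∀ k l : ℕ, k < l →
        Ideal.span {x + y ^ (k + 1)} ≠ Ideal.span {x + y ^ (l + 1)} := by
      intro k l hkl he
      obtain ⟨d, rfl⟩ := Nat.exists_eq_add_of_lt hkl
      have h1 : x + y ^ (k + 1) ∈ Ideal.span {x + y ^ (k + 1)} := Ideal.mem_span_singleton_self _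
      have h2 : x + y ^ (k + d + 1 + 1) ∈ Ideal.span {x + y ^ (k + 1)} := by
        rw [he]; exact Ideal.mem_span_singleton_self _
      have h3 := Ideal.sub_mem _ h1 h2
      have h4 : y ^ (k + 1) * (1 - y ^ (d + 1)) ∈ Ideal.span {x + y ^ (k + 1)} := by
        convert h3 using 1; ring
      have hyu : IsUnit (1 - y ^ (d + 1)) := by
        by_contra hu
        have hy : y ∈ maximalIdeal S := by rw [h]; exact Ideal.subset_span (by simp)
        have hu' : 1 - y ^ (d + 1) ∈ maximalIdeal S := hu
        have := (maximalIdeal S).add_mem hu' ((maximalIdeal S).pow_mem_of_mem hy (d + 1) (by omega))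
        rw [sub_add_cancel] at this
        exact (Ideal.ne_top_iff_one _).1 (Ideal.IsPrime.ne_top inferInstance) this
      rcases (hp k).1.mem_or_mem h4 with h5 | h5
      · exact (hp k).2 ((hp k).1.mem_of_pow_mem _ h5)
      · exact (hp k).1.ne_top (Ideal.eq_top_of_isUnit_mem _ h5 hyu)
    intro k l he
    rcases lt_trichotomy k l with hk | hk | hk
    · exact absurd he (key _ _ hk)
    · exact hk
    · exact absurd he.symm (key _ _ hk)
  have hex : ∃ k : ℕ, Ideal.span {x + y ^ (k + 1)} ∉ minimalPrimes S := by
    by_contra! hc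
    exact Set.infinite_of_injective_forall_mem hinj hc
      (minimalPrimes.finite_of_isNoetherianRing S)
  obtain ⟨k, hk⟩ := hex
  have hpr := (hp k).1
  generalize hz : x + y ^ (k + 1) = z at hk hpr
  obtain ⟨P, hPmin, hPle⟩ := Ideal.exists_minimalPrimes_le (bot_le : ⊥ ≤ Ideal.span {z})
  have hP := hPmin.1.1
  have hzP : z ∉ P := by
    intro hzP
    have : P = Ideal.span {z} := le_antisymm hPle (by simpa [Ideal.span_le] using hzP)
    exact hk (this ▸ hPmin)
  have hbot : P = ⊥ := by
    refine Submodule.eq_bot_of_le_smul_of_le_jacobson_bot (Ideal.span {z}) P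
      (IsNoetherian.noetherian P) ?_ ?_
    · intro p hp
      obtain ⟨a, rfl⟩ := Ideal.mem_span_singleton.1 (hPle hp)
      exact Submodule.smul_mem_smul (Ideal.mem_span_singleton_self z)
        ((hP.mem_or_mem hp).resolve_left hzP)
    · rw [IsLocalRing.jacobson_eq_maximalIdeal ⊥ bot_ne_top]
      exact le_maximalIdeal hpr.ne_top
  subst hbot
  exact IsDomain.of_bot_isPrime S

/-- depth two implies free -/
lemma reg_free {S : Type} [CommRing S] [IsLocalRing S] [IsNoetherianRing S] [IsDomain S]
    (hdim : ringKrullDim S = 2) (x y : S) (h : maximalIdeal S = Ideal.span {x, y})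
    (K : Type) [AddCommGroup K] [Module S K] [Module.Finite S K]
    (hx : IsSMulRegular K x)
    (hxy : ∀ a b : K, x • a = y • b → ∃ c : K, a = y • c ∧ b = x • c) : Module.Free S K := by
  have hxm : x ∈ maximalIdeal S := by rw [h]; exact Ideal.subset_span (by simp)
  have hp := (reg_span_prime hdim x y h).1
  have hyx := (reg_span_prime hdim x y h).2
  have : Module.FinitePresentation S K := Module.finitePresentation_of_finite S K
  rw [← Module.free_quotSMulTop_iff_free (x := x) S K
    (by rwa [IsLocalRing.jacobson_eq_maximalIdeal ⊥ bot_ne_top]) hx]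
  have hloc : IsLocalRing (S ⧸ Ideal.span {x}) :=
    IsLocalRing.of_surjective' (Ideal.Quotient.mk _) Ideal.Quotient.mk_surjective
  have hmax : maximalIdeal (S ⧸ Ideal.span {x}) = Ideal.span {Ideal.Quotient.mk _ y} := by
    have : maximalIdeal (S ⧸ Ideal.span {x}) = (maximalIdeal S).map (Ideal.Quotient.mk _) :=
      (map_maximalIdeal_of_surjective _ Ideal.Quotient.mk_surjective).symm
    rw [this, h, Ideal.map_span, Set.image_pair,
      Ideal.Quotient.eq_zero_iff_mem.2 (Ideal.mem_span_singleton_self x)]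
    simp
  have hPID : IsPrincipalIdealRing (S ⧸ Ideal.span {x}) :=
    ((tfae_of_isNoetherianRing_of_isLocalRing_of_isDomain (S ⧸ Ideal.span {x})).out 4 0).1
      (by rw [hmax]; exact ⟨⟨_, rfl⟩⟩)
  have hy0 : Ideal.Quotient.mk (Ideal.span {x}) y ≠ 0 := by
    rwa [Ne, Ideal.Quotient.eq_zero_iff_mem]
  have hfin : Module.Finite (S ⧸ Ideal.span {x}) (QuotSMulTop x K) :=
    Module.Finite.of_restrictScalars_finite S _ _
  have hyreg : ∀ b : QuotSMulTop x K, (Ideal.Quotient.mk (Ideal.span {x}) y) • b = 0 → b = 0 := by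
    intro b hb
    obtain ⟨b, rfl⟩ := Submodule.Quotient.mk_surjective _ b
    have hb' : (Submodule.Quotient.mk (y • b) : QuotSMulTop x K) = 0 := hb
    rw [Submodule.Quotient.mk_eq_zero] at hb' ⊢
    obtain ⟨a, -, ha⟩ := hb'
    obtain ⟨c, -, rfl⟩ := hxy a b ha
    exact Submodule.smul_mem_pointwise_smul _ _ _ trivial
  have : Module.IsTorsionFree (S ⧸ Ideal.span {x}) (QuotSMulTop x K) := by
    refine Module.IsTorsionFree.of_smul_eq_zero fun r b hrb => ?_
    by_contra! hc
    have hpow : ∀ I : Ideal (S ⧸ Ideal.span {x}), I ≠ ⊥ → ∃ n : ℕ, I = maximalIdeal _ ^ n :=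
      ((tfae_of_isNoetherianRing_of_isLocalRing_of_isDomain
        (S ⧸ Ideal.span {x})).out 0 6).1 hPID
    obtain ⟨k, hk⟩ := hpow (Ideal.span {r}) (by simpa using hc.1)
    rw [hmax, Ideal.span_singleton_pow] at hk
    have hm : (Ideal.Quotient.mk (Ideal.span {x}) y) ^ k ∈ Ideal.span {r} := by
      rw [hk]; exact Ideal.mem_span_singleton_self _
    obtain ⟨s, hs⟩ := Ideal.mem_span_singleton'.1 hm
    have h0 : (Ideal.Quotient.mk (Ideal.span {x}) y) ^ k • b = 0 := by
      rw [← hs, mul_smul, hrb, smul_zero]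
    clear hs hm hk hrb
    induction k with
    | zero => exact hc.2 (by simpa using h0)
    | succ k ih =>
      rw [pow_succ', mul_smul] at h0
      exact ih (hyreg _ h0)
  exact Module.free_of_finite_type_torsion_free'

lemma hom_eq_zero_of_ext_zero {R : Type} [CommRing R]
    (M N : Type) [AddCommGroup M] [Module R M] [AddCommGroup N] [Module R N]
    (h : Subsingleton (ExtGroup R 0 M N)) (φ : M →ₗ[R] N) : φ = 0 := by
  let P := projectiveResolution (ModuleCat.of R M)
  have hz : Limits.IsZero ((P.complex.linearYonedaObj R (ModuleCat.of R N)).homology 0) :=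
    (ModuleCat.isZero_of_subsingleton _).of_iso (P.isoExt 0 (ModuleCat.of R N)).symm
  rw [← HomologicalComplex.exactAt_iff_isZero_homology,
    HomologicalComplex.exactAt_iff' _ 0 0 1 (by simp) (by simp),
    ShortComplex.moduleCat_exact_iff] at hz
  have hd0 : (P.complex.linearYonedaObj R (ModuleCat.of R N)).d 0 0 = 0 :=
    HomologicalComplex.shape _ _ _ (by simp)
  let q : P.complex.X 0 →ₗ[R] M := (P.π.f 0).hom
  have hq : Function.Surjective q := (ModuleCat.epi_iff_surjective (P.π.f 0)).1 inferInstance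
  let g : P.complex.X 0 ⟶ ModuleCat.of R N := ModuleCat.ofHom (φ ∘ₗ q)
  have hg : P.complex.d 1 0 ≫ g = 0 := by
    ext w
    have : q ((P.complex.d 1 0).hom w) = 0 :=
      congrArg (fun f => f.hom w) P.complex_d_comp_π_f_zero
    change φ (q ((P.complex.d 1 0).hom w)) = 0
    rw [this, map_zero]
  obtain ⟨w, hw⟩ := hz g hg
  have hg0 : g = 0 := by
    rw [← hw]
    change (P.complex.linearYonedaObj R (ModuleCat.of R N)).d 0 0 w = 0
    rw [hd0]; rfl
  ext z
  obtain ⟨w, rfl⟩ := hq z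
  exact congrArg (fun f => f.hom w) hg0

lemma ext_one_of_extend {R : Type} [CommRing R]
    (M T : Type) [AddCommGroup M] [Module R M] [AddCommGroup T] [Module R T]
    (h : ∀ (P : Type) [AddCommGroup P] [Module R P] [Module.Projective R P]
      (q : P →ₗ[R] M) (_ : Function.Surjective q) (g : LinearMap.ker q →ₗ[R] T),
        ∃ e : P →ₗ[R] T, ∀ z : LinearMap.ker q, e z = g z) :
    Subsingleton (ExtGroup R 1 M T) := by
  let P := projectiveResolution (ModuleCat.of R M)
  suffices hz : Limits.IsZero ((P.complex.linearYonedaObj R (ModuleCat.of R T)).homology 1) from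
    ModuleCat.subsingleton_of_isZero (hz.of_iso (P.isoExt 1 (ModuleCat.of R T)))
  rw [← HomologicalComplex.exactAt_iff_isZero_homology,
    HomologicalComplex.exactAt_iff' _ 0 1 2 (by simp) (by simp),
    ShortComplex.moduleCat_exact_iff]
  intro (g : P.complex.X 1 ⟶ ModuleCat.of R T) (hg : P.complex.d 2 1 ≫ g = 0)
  suffices H : ∃ e : P.complex.X 0 ⟶ ModuleCat.of R T, P.complex.d 1 0 ≫ e = g from H
  have hex1 := (ShortComplex.moduleCat_exact_iff _).1 (P.exact_succ 0)
  have hex0 := (ShortComplex.moduleCat_exact_iff _).1 P.exact₀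
  let q : P.complex.X 0 →ₗ[R] M := (P.π.f 0).hom
  have hq : Function.Surjective q := (ModuleCat.epi_iff_surjective (P.π.f 0)).1 inferInstance
  have hproj : Module.Projective R (P.complex.X 0) := 
    (IsProjective.iff_projective _).2 (P.projective 0)
  let d : P.complex.X 1 →ₗ[R] LinearMap.ker q := LinearMap.codRestrict _ (P.complex.d 1 0).hom (by
    intro c
    exact congrArg (fun f => f.hom c) P.complex_d_comp_π_f_zero)
  have hd : Function.Surjective d := by
    rintro ⟨z, hz⟩
    obtain ⟨w, hw⟩ := hex0 z hz
    exact ⟨w, Subtype.ext hw⟩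
  have hker : LinearMap.ker d ≤ LinearMap.ker g.hom := by
    intro w hw
    obtain ⟨v, rfl⟩ := hex1 w (congrArg Subtype.val hw)
    exact congrArg (fun f => f.hom v) hg
  obtain ⟨s, hs⟩ : ∃ s : LinearMap.ker q →ₗ[R] T, s ∘ₗ d = g.hom :=
    ⟨(LinearMap.ker d).liftQ g.hom hker ∘ₗ (d.quotKerEquivOfSurjective hd).symm, by
      ext w
      have : (d.quotKerEquivOfSurjective hd).symm (d w) = Submodule.Quotient.mk w := by
        rw [LinearEquiv.symm_apply_eq]; rfl
      simp [this]⟩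
  obtain ⟨e, he⟩ := h _ q hq s
  refine ⟨ModuleCat.ofHom e, ?_⟩
  ext w
  have := LinearMap.congr_fun hs w
  rw [← this]
  exact he (d w)

lemma ext_one_of_kill {R : Type} [CommRing R]
    (M T F : Type) [AddCommGroup M] [Module R M] [AddCommGroup T] [Module R T]
    [AddCommGroup F] [Module R F] [Module.Projective R F]
    (p : F →ₗ[R] M) (hp : Function.Surjective p) (c : R)
    (hc : ∀ z, p z = 0 → c • z = 0) (hT : ∀ t : T, c • t = 0 → t = 0) :
    Subsingleton (ExtGroup R 1 M T) := by
  refine ext_one_of_extend M T fun P _ _ _ q hq g => ?_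
  obtain ⟨φ, hφ⟩ := Module.projective_lifting_property q p hq
  obtain ⟨ψ, hψ⟩ := Module.projective_lifting_property p q hp
  have hφ' (z) : q (φ z) = p z := LinearMap.congr_fun hφ z
  have hψ' (z) : p (ψ z) = q z := LinearMap.congr_fun hψ z
  let r : P →ₗ[R] LinearMap.ker q :=
    LinearMap.codRestrict _ (LinearMap.id - φ ∘ₗ ψ) (by intro z; simp [hφ', hψ'])
  refine ⟨g ∘ₗ r, fun z => ?_⟩
  have hmem : q (φ (ψ z)) = 0 := by rw [hφ', hψ']; exact z.2
  have h1 : r z = z - ⟨φ (ψ z), hmem⟩ := Subtype.ext rfl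
  have h2 : g ⟨φ (ψ z), hmem⟩ = 0 := by
    apply hT
    rw [← map_smul]
    have : c • (⟨φ (ψ z), hmem⟩ : LinearMap.ker q) = 0 := by
      apply Subtype.ext
      change c • φ (ψ z) = 0
      rw [← map_smul, hc _ ((hψ' _).trans z.2), map_zero]
    rw [this, map_zero]
  rw [LinearMap.comp_apply, h1, map_sub, h2, sub_zero]

lemma depth_one_socle {R : Type} [CommRing R] [IsLocalRing R]
    (N : Type) [AddCommGroup N] [Module R N] (h : moduleDepth R N = 1)
    (z : N) (hz : ∀ r ∈ maximalIdeal R, r • z = 0) : z = 0 := by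
  have h0 : Subsingleton (ExtGroup R 0 (ResidueField R) N) := by
    by_contra hc
    rw [not_subsingleton_iff_nontrivial] at hc
    have : moduleDepth R N ≤ 0 := sInf_le ⟨0, by simp, hc⟩
    rw [h] at this
    exact absurd this (by simp)
  let φ : ResidueField R →ₗ[R] N :=
    (maximalIdeal R).liftQ (LinearMap.toSpanSingleton R N z) (fun r hr => hz r hr)
  have := LinearMap.congr_fun (hom_eq_zero_of_ext_zero _ N h0 φ) (Submodule.Quotient.mk 1)
  have h1 : φ (Submodule.Quotient.mk 1) = (1 : R) • z := rfl
  rw [one_smul] at h1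
  rw [← h1, this]
  rfl

lemma prod_dvd_of_dvd_mul {S ι : Type} [CommRing S] [IsDomain S] (f : ι → S)
    (hf : ∀ i, Prime (f i)) (a : S) (J : Finset ι) (hJ : ∀ j ∈ J, ¬ f j ∣ a) :
    ∀ s, (∏ j ∈ J, f j) ∣ a * s → (∏ j ∈ J, f j) ∣ s := by
  classical
  induction J using Finset.induction_on with
  | empty => simp
  | insert p J hp ih =>
    intro s hs
    rw [Finset.prod_insert hp] at hs ⊢
    have h1 : f p ∣ s := ((hf p).dvd_or_dvd ((dvd_mul_right _ _).trans hs)).resolve_left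
      (hJ p (Finset.mem_insert_self _ _))
    obtain ⟨t, rfl⟩ := h1
    refine mul_dvd_mul_left _ (ih (fun j hj => hJ j (Finset.mem_insert_of_mem hj)) t ?_)
    rw [mul_left_comm] at hs
    exact (mul_dvd_mul_iff_left (hf p).ne_zero).1 hs

/-- The preimage in `S^m` of the syzygy. -/
def preSyz {S : Type} [CommRing S] (F : S) (N : Type) [AddCommGroup N]
    [Module (S ⧸ Ideal.span {F}) N] (m : ℕ)
    (π : (Fin m → (S ⧸ Ideal.span {F})) →ₗ[S ⧸ Ideal.span {F}] N) :
    Submodule S (Fin m → S) :=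
  ((LinearMap.ker π).restrictScalars S).comap
    (LinearMap.compLeft (Ideal.Quotient.mkₐ S (Ideal.span {F})).toLinearMap (Fin m))

lemma mem_preSyz {S : Type} [CommRing S] (F : S) (N : Type) [AddCommGroup N]
    [Module (S ⧸ Ideal.span {F}) N] (m : ℕ)
    (π : (Fin m → (S ⧸ Ideal.span {F})) →ₗ[S ⧸ Ideal.span {F}] N) (s : Fin m → S) :
    s ∈ preSyz F N m π ↔ π (fun i => Ideal.Quotient.mk _ (s i)) = 0 := Iff.rfl

lemma pi_smul_mk {S : Type} [CommRing S] (F : S) (N : Type) [AddCommGroup N]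
    [Module (S ⧸ Ideal.span {F}) N] (m : ℕ)
    (π : (Fin m → (S ⧸ Ideal.span {F})) →ₗ[S ⧸ Ideal.span {F}] N) (a : S) (s : Fin m → S) :
    π (fun i => Ideal.Quotient.mk _ ((a • s) i)) =
      Ideal.Quotient.mk (Ideal.span {F}) a • π (fun i => Ideal.Quotient.mk _ (s i)) := by
  rw [← map_smul]
  congr 1

lemma preSyz_free {S : Type} [CommRing S] [IsLocalRing S] [IsNoetherianRing S]
    (hdim : ringKrullDim S = 2) (x y : S) (h : maximalIdeal S = Ideal.span {x, y})
    (F : S) [IsLocalRing (S ⧸ Ideal.span {F})] (N : Type) [AddCommGroup N]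
    [Module (S ⧸ Ideal.span {F}) N] (hN : moduleDepth (S ⧸ Ideal.span {F}) N = 1) (m : ℕ)
    (π : (Fin m → (S ⧸ Ideal.span {F})) →ₗ[S ⧸ Ideal.span {F}] N) :
    Module.Free S (preSyz F N m π) := by
  have : IsDomain S := reg_isDomain hdim x y h
  have hp := (reg_span_prime hdim x y h).1
  have hyx := (reg_span_prime hdim x y h).2
  have hx0 : x ≠ 0 := by
    rintro rfl
    have hpr : (maximalIdeal S).IsPrincipal := by rw [h]; exact ⟨⟨y, by simp⟩⟩
    have h1 := Ideal.height_le_one_of_isPrincipal_of_mem_minimalPrimes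
      (maximalIdeal S) (maximalIdeal S) ⟨⟨inferInstance, le_rfl⟩, fun Q hQ _ => hQ.2⟩
    have h2 := IsLocalRing.maximalIdeal_height_eq_ringKrullDim (R := S)
    rw [hdim] at h2
    have h3 : (maximalIdeal S).height = 2 := WithBot.coe_injective h2
    rw [h3] at h1
    exact absurd h1 (by decide)
  refine reg_free hdim x y h _ ?_ ?_
  · intro a b hab
    apply Subtype.ext
    have hab' : x • (a : Fin m → S) = x • (b : Fin m → S) := congrArg Subtype.val hab
    ext i
    exact mul_left_cancel₀ hx0 (congrFun hab' i)
  · rintro ⟨a, ha⟩ ⟨b, hb⟩ hab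
    have hab' : x • a = y • b := congrArg Subtype.val hab
    have hi (i : Fin m) : x * a i = y * b i := congrFun hab' i
    have hdvd (i : Fin m) : ∃ c, b i = x * c := by
      have h1 : y * b i ∈ Ideal.span {x} := Ideal.mem_span_singleton.2 ⟨a i, (hi i).symm⟩
      exact Ideal.mem_span_singleton.1 ((hp.mem_or_mem h1).resolve_left hyx)
    choose c hc using hdvd
    have hbc : b = x • c := funext hc
    have hac : a = y • c := by
      ext i
      apply mul_left_cancel₀ hx0
      rw [hi, hc]
      simp only [Pi.smul_apply, smul_eq_mul]
      ring
    have hcm : c ∈ preSyz F N m π := by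
      rw [mem_preSyz]
      refine depth_one_socle N hN _ fun r hr => ?_
      rw [← map_maximalIdeal_of_surjective (Ideal.Quotient.mk (Ideal.span {F}))
        Ideal.Quotient.mk_surjective] at hr
      obtain ⟨s, hs, rfl⟩ :=
        (Ideal.mem_map_iff_of_surjective _ Ideal.Quotient.mk_surjective).1 hr
      rw [h] at hs
      obtain ⟨u, v, rfl⟩ := Ideal.mem_span_pair.1 hs
      rw [mem_preSyz, hac, pi_smul_mk] at ha
      rw [mem_preSyz, hbc, pi_smul_mk] at hb
      rw [map_add, map_mul, map_mul, add_smul, mul_smul, mul_smul, ha, hb]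
      simp
    exact ⟨⟨c, hcm⟩, Subtype.ext hac, Subtype.ext hbc⟩

lemma exists_cover {S : Type} [CommRing S] (F c : S) (N : Type) [AddCommGroup N]
    [Module (S ⧸ Ideal.span {F}) N] (m : ℕ)
    (π : (Fin m → (S ⧸ Ideal.span {F})) →ₗ[S ⧸ Ideal.span {F}] N)
    (hkill : ∀ z : N, Ideal.Quotient.mk (Ideal.span {F}) c • z = 0) :
    ∃ p : TensorProduct S (S ⧸ Ideal.span {F}) (preSyz F N m π) →ₗ[S ⧸ Ideal.span {F}]
        LinearMap.ker π, Function.Surjective p ∧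
      ∀ z, p z = 0 → Ideal.Quotient.mk (Ideal.span {F}) c • z = 0 := by
  let p₀ : preSyz F N m π →ₗ[S] LinearMap.ker π :=
    { toFun := fun k => ⟨fun i => Ideal.Quotient.mk _ (k.1 i), k.2⟩
      map_add' := fun a b => by apply Subtype.ext; ext i; simp
      map_smul' := fun a b => by
        apply Subtype.ext; ext i
        simp [Algebra.smul_def] }
  have hrep : ∀ z : TensorProduct S (S ⧸ Ideal.span {F}) (preSyz F N m π), ∃ k, z = 1 ⊗ₜ[S] k := by
    intro z
    induction z using TensorProduct.induction_on with
    | zero => exact ⟨0, by simp⟩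
    | tmul r k =>
      obtain ⟨s, rfl⟩ := Ideal.Quotient.mk_surjective r
      refine ⟨s • k, ?_⟩
      rw [← TensorProduct.smul_tmul, Algebra.smul_def, mul_one]
      rfl
    | add a b ha hb =>
      obtain ⟨k, rfl⟩ := ha
      obtain ⟨l, rfl⟩ := hb
      exact ⟨k + l, by rw [TensorProduct.tmul_add]⟩
  refine ⟨p₀.liftBaseChange _, ?_, ?_⟩
  · rintro ⟨w, hw⟩
    choose s hs using fun i => Ideal.Quotient.mk_surjective (w i)
    have hsw : (fun i => Ideal.Quotient.mk (Ideal.span {F}) (s i)) = w := funext hs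
    refine ⟨1 ⊗ₜ[S] ⟨s, by rw [mem_preSyz, hsw]; exact hw⟩, ?_⟩
    rw [LinearMap.liftBaseChange_tmul, one_smul]
    exact Subtype.ext hsw
  · intro z hz
    obtain ⟨⟨k, hk⟩, rfl⟩ := hrep z
    rw [LinearMap.liftBaseChange_tmul, one_smul] at hz
    have hz' (i) : ∃ s, k i = F * s := by
      have : Ideal.Quotient.mk (Ideal.span {F}) (k i) = 0 := congrFun (congrArg Subtype.val hz) i
      exact Ideal.mem_span_singleton.1 (Ideal.Quotient.eq_zero_iff_mem.1 this)
    choose s hs using hz'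
    have hcs : c • s ∈ preSyz F N m π := by rw [mem_preSyz, pi_smul_mk, hkill]
    have h1 : c • (⟨k, hk⟩ : preSyz F N m π) = F • ⟨c • s, hcs⟩ := by
      apply Subtype.ext
      ext i
      simp only [Submodule.coe_smul, Pi.smul_apply, smul_eq_mul, hs]
      ring
    have h2 : ∀ (a : S) (k : preSyz F N m π), Ideal.Quotient.mk (Ideal.span {F}) a •
        ((1 : S ⧸ Ideal.span {F}) ⊗ₜ[S] k) = 1 ⊗ₜ[S] (a • k) := by
      intro a k
      rw [TensorProduct.smul_tmul', ← TensorProduct.smul_tmul, Algebra.smul_def a, smul_eq_mul]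
      rfl
    rw [h2, h1, ← h2, Ideal.Quotient.eq_zero_iff_mem.2 (Ideal.mem_span_singleton_self F),
      zero_smul]

/-- Let `S` be a `2`-dimensional complete regular local ring, `f = f_1 ⋯ f_n` a product of
pairwise non-associate primes, `R = S/(f)`.  Let `I, J` be disjoint subsets of `{1,…,n}`,
`N` a maximal Cohen-Macaulay `S_I`-module (an `R`-module of depth one killed by `f_I`),
and `M` the first `R`-syzygy of `N` (the kernel of a minimal free cover).  Then
`Ext_R^1(M, S_J) = 0`. -/
theorem ext_one_syzygy_SJ_vanishes
    (S : Type) [CommRing S] [IsLocalRing S] (hS : IsRegularLocalTwoDim S)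
    (hcomp : IsAdicComplete (IsLocalRing.maximalIdeal S) S)
    (n : ℕ) (f : Fin n → S) (hprime : ∀ i, Prime (f i))
    (hassoc : ∀ i j, i ≠ j → ¬Associated (f i) (f j))
    [IsLocalRing (S ⧸ Ideal.span {∏ i, f i})]
    (I J : Finset (Fin n)) (hdisj : Disjoint I J)
    (N : Type) [AddCommGroup N] [Module (S ⧸ Ideal.span {∏ i, f i}) N]
    (hNfin : Module.Finite (S ⧸ Ideal.span {∏ i, f i}) N)
    (hNdepth : moduleDepth (S ⧸ Ideal.span {∏ i, f i}) N = 1)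
    (hNkill : ∀ x : N, (Ideal.Quotient.mk (Ideal.span {∏ i, f i}) (∏ i ∈ I, f i)) • x = 0)
    (m : ℕ)
    (π : (Fin m → (S ⧸ Ideal.span {∏ i, f i})) →ₗ[S ⧸ Ideal.span {∏ i, f i}] N)
    (hπ : Function.Surjective π)
    (hmin : LinearMap.ker π ≤
      (IsLocalRing.maximalIdeal (S ⧸ Ideal.span {∏ i, f i})) • ⊤) :
    Subsingleton (ExtGroup (S ⧸ Ideal.span {∏ i, f i}) 1 (LinearMap.ker π)
      ((S ⧸ Ideal.span {∏ i, f i}) ⧸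
        Ideal.span {Ideal.Quotient.mk (Ideal.span {∏ i, f i}) (∏ i ∈ J, f i)})) := by
  obtain ⟨hnoeth, hdim, x, y, hxy⟩ := hS
  have hdom : IsDomain S := reg_isDomain hdim x y hxy
  obtain ⟨p, hp, hpk⟩ := exists_cover (∏ i, f i) (∏ i ∈ I, f i) N m π hNkill
  have hfree := preSyz_free hdim x y hxy (∏ i, f i) N hNdepth m π
  refine ext_one_of_kill _ _ _ p hp _ hpk ?_
  intro t ht
  obtain ⟨r, rfl⟩ := Ideal.Quotient.mk_surjective t
  obtain ⟨s, rfl⟩ := Ideal.Quotient.mk_surjective r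
  have ht' : Ideal.Quotient.mk (Ideal.span {Ideal.Quotient.mk (Ideal.span {∏ i, f i})
      (∏ i ∈ J, f i)}) (Ideal.Quotient.mk _ ((∏ i ∈ I, f i) * s)) = 0 := by
    rw [map_mul]; exact ht
  rw [Ideal.Quotient.eq_zero_iff_mem] at ht' ⊢
  rw [Ideal.mem_span_singleton] at ht' ⊢
  obtain ⟨u, hu⟩ := ht'
  obtain ⟨u, rfl⟩ := Ideal.Quotient.mk_surjective u
  rw [← map_mul, Ideal.Quotient.eq, Ideal.mem_span_singleton] at hu
  have hJ : (∏ i ∈ J, f i) ∣ ∏ i, f i := Finset.prod_dvd_prod_of_subset _ _ _ (Finset.subset_univ _)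
  have h1 : (∏ i ∈ J, f i) ∣ (∏ i ∈ I, f i) * s :=
    (dvd_sub_left (dvd_mul_right _ _)).1 (hJ.trans hu)
  refine map_dvd _ (prod_dvd_of_dvd_mul f hprime _ J ?_ s h1)
  intro j hj hd
  obtain ⟨i, hi, hd⟩ := (hprime j).exists_mem_finset_dvd hd
  refine hassoc j i ?_ ((hprime j).associated_of_dvd (hprime i) hd)
  rintro rfl
  exact Finset.disjoint_left.1 hdisj hi hj
end

section
/- Let S be a 2-dimensional complete regular local ring, f = gh with g, h coprime, R = S/(f), and set T = S/(h). For maximal Cohen-Macaulay T-modules M, N, one has Ext_R^1(M, N) = 0 if and only if Ext_T^1(M, N) = 0. -/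
open CategoryTheory Opposite IsLocalRing

lemma extAux_iff (R : Type) [CommRing R] (M N : ModuleCat.{0} R) (P : ProjectiveResolution M) (n i k : ℕ)
    (hi : (ComplexShape.up ℕ).prev n = i) (hk : (ComplexShape.up ℕ).next n = k) :
    Subsingleton (((Ext R (ModuleCat R) n).obj (op M)).obj N) ↔
      ∀ f : P.complex.X n ⟶ N, P.complex.d k n ≫ f = 0 →
        ∃ e : P.complex.X i ⟶ N, P.complex.d n i ≫ e = f := by
  rw [← ModuleCat.isZero_iff_subsingleton]
  rw [(P.isoExt (R := R) n N).isZero_iff, ← HomologicalComplex.exactAt_iff_isZero_homology,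
    HomologicalComplex.exactAt_iff' _ i n k hi hk, ShortComplex.moduleCat_exact_iff]
  exact Iff.rfl

lemma ext_zero_of (R : Type) [CommRing R] (M N : ModuleCat.{0} R)
    (hs : Subsingleton (((Ext R (ModuleCat R) 0).obj (op M)).obj N)) (φ : M ⟶ N) : φ = 0 := by
  let P := projectiveResolution M
  rw [extAux_iff R M N P 0 0 1 (by simp) (by simp)] at hs
  let π : P.complex.X 0 ⟶ M := P.π.f 0
  have hπ : P.complex.d 1 0 ≫ π = 0 := P.complex_d_comp_π_f_zero
  have hepi : Epi π := inferInstanceAs (Epi (P.π.f 0))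
  obtain ⟨e, he⟩ := hs (π ≫ φ) (by rw [← Category.assoc, hπ, Limits.zero_comp])
  rw [P.complex.shape _ _ (by simp), Limits.zero_comp] at he
  rw [← cancel_epi π, ← he, Limits.comp_zero]

def SplitProp (R : Type) [CommRing R] (M N : Type) [AddCommGroup M] [Module R M] [AddCommGroup N]
    [Module R N] : Prop :=
  ∀ (Q : Type) [AddCommGroup Q] [Module R Q] (i : N →ₗ[R] Q) (p : Q →ₗ[R] M),
    Function.Injective i → Function.Exact i p → Function.Surjective p →
    ∃ s : M →ₗ[R] Q, p ∘ₗ s = LinearMap.id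

lemma split_iff_proj (R : Type) [CommRing R] (M N P₀ P₁ P₂ : Type) [AddCommGroup M] [Module R M]
    [AddCommGroup N] [Module R N] [AddCommGroup P₀] [Module R P₀] [AddCommGroup P₁] [Module R P₁]
    [AddCommGroup P₂] [Module R P₂] [Module.Projective R P₀]
    (d₂ : P₂ →ₗ[R] P₁) (d₁ : P₁ →ₗ[R] P₀) (π : P₀ →ₗ[R] M) (h₂ : Function.Exact d₂ d₁)
    (h₁ : Function.Exact d₁ π) (hπ : Function.Surjective π) :
    (∀ f : P₁ →ₗ[R] N, f ∘ₗ d₂ = 0 → ∃ e : P₀ →ₗ[R] N, e ∘ₗ d₁ = f) ↔ SplitProp R M N := by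
  constructor
  · intro H Q _ _ i p hi hip hp
    obtain ⟨φ, hφ⟩ := Module.projective_lifting_property p π hp
    have hφ' : ∀ x, p (φ x) = π x := fun x => by rw [← hφ]; rfl
    have hmem : ∀ x, φ (d₁ x) ∈ LinearMap.range i := fun x => by
      rw [LinearMap.mem_range]
      exact (hip _).1 (by rw [hφ']; exact h₁.apply_apply_eq_zero x)
    let i' := LinearEquiv.ofInjective i hi
    let f : P₁ →ₗ[R] N := i'.symm.toLinearMap ∘ₗ (φ ∘ₗ d₁).codRestrict (LinearMap.range i) hmem
    have hf : ∀ x, i (f x) = φ (d₁ x) := fun x => by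
      have : i' (f x) = (φ ∘ₗ d₁).codRestrict (LinearMap.range i) hmem x := by simp [f]
      exact congrArg Subtype.val this
    obtain ⟨e, he⟩ := H f (by
      ext x
      apply hi
      simp [hf, h₂.apply_apply_eq_zero])
    have he' : ∀ x, e (d₁ x) = f x := fun x => by rw [← he]; rfl
    let ψ := φ - i ∘ₗ e
    have hψ : LinearMap.ker π ≤ LinearMap.ker ψ := by
      intro x hx
      obtain ⟨y, rfl⟩ := (h₁ x).1 hx
      simp [ψ, he', hf]
    let s := (LinearMap.ker π).liftQ ψ hψ ∘ₗ (π.quotKerEquivOfSurjective hπ).symm.toLinearMap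
    refine ⟨s, ?_⟩
    ext m
    obtain ⟨x, rfl⟩ := hπ m
    have h1 : (π.quotKerEquivOfSurjective hπ).symm (π x) = Submodule.Quotient.mk x := by
      rw [LinearEquiv.symm_apply_eq]; rfl
    have : s (π x) = ψ x := by
      simp only [s, LinearMap.comp_apply, LinearEquiv.coe_coe, h1]; rfl
    simp [this, ψ, hφ', hip.apply_apply_eq_zero]
  · intro H f hf
    have hf' : ∀ x, f (d₂ x) = 0 := fun x => LinearMap.congr_fun hf x
    let L : Submodule R (N × P₀) := LinearMap.range (f.prod (-d₁))
    have hL : ∀ x, (f x, - d₁ x) ∈ L := fun x => ⟨x, rfl⟩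
    let i : N →ₗ[R] (N × P₀) ⧸ L := L.mkQ ∘ₗ LinearMap.inl R N P₀
    let p : ((N × P₀) ⧸ L) →ₗ[R] M := L.liftQ (π ∘ₗ LinearMap.snd R N P₀) (by
      rintro _ ⟨x, rfl⟩
      simp [h₁.apply_apply_eq_zero])
    have hp : ∀ n x, p (L.mkQ (n, x)) = π x := fun n x => rfl
    obtain ⟨s, hs⟩ := H _ i p (by
        rw [← LinearMap.ker_eq_bot, LinearMap.ker_eq_bot']
        intro n hn
        have : (n, (0 : P₀)) ∈ L := by
          simpa [i] using hn
        obtain ⟨x, hx⟩ := this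
        have h3 : f x = n := congrArg Prod.fst hx
        have h4 : - d₁ x = 0 := congrArg Prod.snd hx
        obtain ⟨y, rfl⟩ := (h₂ x).1 (by simpa using h4)
        rw [← h3, hf']) (by
        intro q
        obtain ⟨⟨n, x⟩, rfl⟩ := L.mkQ_surjective q
        rw [hp]
        constructor
        · intro hx
          obtain ⟨y, rfl⟩ := (h₁ x).1 hx
          refine ⟨n + f y, ?_⟩
          change L.mkQ (n + f y, 0) = _
          rw [← sub_eq_zero, ← map_sub]
          rw [Submodule.mkQ_apply, Submodule.Quotient.mk_eq_zero]
          simpa using hL y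
        · rintro ⟨n', hn'⟩
          have : p (i n') = π x := by rw [hn', hp]
          rw [← this]
          change p (L.mkQ (n', 0)) = 0
          rw [hp, map_zero]) (fun m => by
        obtain ⟨x, rfl⟩ := hπ m
        exact ⟨L.mkQ (0, x), rfl⟩)
    have hs' : ∀ m, p (s m) = m := fun m => LinearMap.congr_fun hs m
    have hi : Function.Injective i := by
        rw [← LinearMap.ker_eq_bot, LinearMap.ker_eq_bot']
        intro n hn
        have : (n, (0 : P₀)) ∈ L := by
          simpa [i] using hn
        obtain ⟨x, hx⟩ := this
        have h3 : f x = n := congrArg Prod.fst hx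
        have h4 : - d₁ x = 0 := congrArg Prod.snd hx
        obtain ⟨y, rfl⟩ := (h₂ x).1 (by simpa using h4)
        rw [← h3, hf']
    have hip : ∀ q, p q = 0 → q ∈ LinearMap.range i := by
        intro q hx
        obtain ⟨⟨n, x⟩, rfl⟩ := L.mkQ_surjective q
        rw [hp] at hx
        obtain ⟨y, rfl⟩ := (h₁ x).1 hx
        refine ⟨n + f y, ?_⟩
        change L.mkQ (n + f y, 0) = _
        rw [← sub_eq_zero, ← map_sub]
        rw [Submodule.mkQ_apply, Submodule.Quotient.mk_eq_zero]
        simpa using hL y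
    let i' := LinearEquiv.ofInjective i hi
    let j : P₀ →ₗ[R] (N × P₀) ⧸ L := L.mkQ ∘ₗ LinearMap.inr R N P₀
    have hj : ∀ x, p (j x) = π x := fun x => rfl
    let e : P₀ →ₗ[R] N := i'.symm.toLinearMap ∘ₗ
      (j - s ∘ₗ π).codRestrict (LinearMap.range i) (fun x => hip _ (by simp [hj, hs']))
    have he : ∀ x, i (e x) = j x - s (π x) := fun x => by
      have : i' (e x) = (j - s ∘ₗ π).codRestrict (LinearMap.range i) 
        (fun x => hip _ (by simp [hj, hs'])) x := by simp [e]
      exact congrArg Subtype.val this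
    refine ⟨e, ?_⟩
    ext x
    apply hi
    change i (e (d₁ x)) = _
    rw [he, h₁.apply_apply_eq_zero, map_zero, sub_zero]
    change L.mkQ (0, d₁ x) = L.mkQ (f x, 0)
    rw [eq_comm, ← sub_eq_zero, ← map_sub]
    rw [Submodule.mkQ_apply, Submodule.Quotient.mk_eq_zero]
    simpa using hL x

lemma ext_one_iff (R : Type) [CommRing R] (M N : Type) [AddCommGroup M] [Module R M]
    [AddCommGroup N] [Module R N] : Subsingleton (ExtGroup R 1 M N) ↔ SplitProp R M N := by
  let P := projectiveResolution (ModuleCat.of R M)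
  have : Module.Projective R (P.complex.X 0) := by
    have := P.projective 0
    rwa [IsProjective.iff_projective]
  have h2 := P.exact_succ 0
  have h1 : (ShortComplex.mk _ _ P.complex_d_comp_π_f_zero).Exact :=
    ShortComplex.exact_of_g_is_cokernel _ P.isColimitCokernelCofork
  rw [ShortComplex.ShortExact.moduleCat_exact_iff_function_exact] at h1 h2
  let π : P.complex.X 0 →ₗ[R] M := (P.π.f 0).hom
  rw [← split_iff_proj R M N (P.complex.X 0) (P.complex.X 1) (P.complex.X 2) (P.complex.d 2 1).hom
    (P.complex.d 1 0).hom π h2 h1 ((ModuleCat.epi_iff_surjective _).1 (inferInstance : Epi (P.π.f 0)))]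
  rw [extAux_iff R _ _ P 1 0 2 (by simp) (by simp)]
  constructor
  · intro H f hf
    obtain ⟨e, he⟩ := H (ModuleCat.ofHom f) (by ext x; exact LinearMap.congr_fun hf x)
    exact ⟨e.hom, by rw [← ModuleCat.hom_comp, he]; rfl⟩
  · intro H f hf
    obtain ⟨e, he⟩ := H f.hom (by rw [← ModuleCat.hom_comp, hf]; rfl)
    exact ⟨ModuleCat.ofHom e, by ext x; exact LinearMap.congr_fun he x⟩

lemma principal_of_ne (S : Type) [CommRing S] [IsLocalRing S] [IsNoetherianRing S] (x y : S)
    (hm : IsLocalRing.maximalIdeal S = Ideal.span {x, y}) (P : Ideal S) (hP : P.IsPrime)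
    (hx : x ∉ P) : P.IsPrincipal := by
  have hxm : x ∈ maximalIdeal S := by rw [hm]; exact Ideal.subset_span (by simp)
  have hym : y ∈ maximalIdeal S := by rw [hm]; exact Ideal.subset_span (by simp)
  let A := S ⧸ Ideal.span {x}
  let q : S →+* A := Ideal.Quotient.mk _
  have hq : Function.Surjective q := Ideal.Quotient.mk_surjective
  have hqx : q x = 0 := Ideal.Quotient.eq_zero_iff_mem.2 (Ideal.mem_span_singleton_self x)
  have hpir : IsPrincipalIdealRing A := by
    apply IsPrincipalIdealRing.of_prime
    intro I hI
    have hle : I.comap q ≤ maximalIdeal S := IsLocalRing.le_maximalIdeal (hI.comap q).ne_top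
    by_cases hy : q y ∈ I
    · refine ⟨⟨q y, ?_⟩⟩
      apply le_antisymm
      · intro a ha
        obtain ⟨s, rfl⟩ := hq a
        have hs : s ∈ maximalIdeal S := hle ha
        rw [hm, Ideal.mem_span_pair] at hs
        obtain ⟨a, b, rfl⟩ := hs
        exact Ideal.mem_span_singleton'.2 ⟨q b, by simp [hqx]⟩
      · exact (Ideal.span_singleton_le_iff_mem _).2 hy
    · have hbot : I = ⊥ := by
        apply Submodule.eq_bot_of_le_smul_of_le_jacobson_bot (Ideal.span {q y}) I
          (IsNoetherian.noetherian I)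
        · intro a ha
          obtain ⟨s, rfl⟩ := hq a
          have hs : s ∈ maximalIdeal S := hle ha
          rw [hm, Ideal.mem_span_pair] at hs
          obtain ⟨a, b, rfl⟩ := hs
          have h1 : q (a * x + b * y) = q y * q b := by simp [hqx, mul_comm]
          rw [h1] at ha ⊢
          exact Ideal.mul_mem_mul (Ideal.mem_span_singleton_self _) ((hI.mem_or_mem ha).resolve_left hy)
        · rw [Ideal.span_singleton_le_iff_mem, Ideal.mem_jacobson_bot]
          intro a
          obtain ⟨s, rfl⟩ := hq a
          have : IsUnit (y * s + 1) := by
            by_contra hc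
            have h2 : y * s + 1 ∈ maximalIdeal S := hc
            have h3 : (1 : S) ∈ maximalIdeal S := by
              have := Ideal.sub_mem _ h2 (Ideal.mul_mem_right s _ hym)
              simpa using this
            exact (Ideal.ne_top_iff_one _).1 (maximalIdeal.isMaximal S).ne_top h3
          simpa using this.map q
      rw [hbot]; infer_instance
  obtain ⟨⟨a, ha⟩⟩ := hpir.principal (P.map q)
  have ham : a ∈ P.map q := by rw [ha]; exact Ideal.mem_span_singleton_self a
  obtain ⟨p, hp, rfl⟩ := (Ideal.mem_map_iff_of_surjective q hq).1 ham
  refine ⟨⟨p, ?_⟩⟩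
  apply le_antisymm
  · apply Submodule.le_of_le_smul_of_le_jacobson_bot (I := Ideal.span {x}) (IsNoetherian.noetherian P)
    · rw [Ideal.span_singleton_le_iff_mem, IsLocalRing.jacobson_eq_maximalIdeal ⊥ bot_ne_top]
      exact hxm
    · intro z hz
      have hz' : q z ∈ P.map q := Ideal.mem_map_of_mem q hz
      rw [ha] at hz'
      obtain ⟨c, hc⟩ := Ideal.mem_span_singleton'.1 hz'
      obtain ⟨c, rfl⟩ := hq c
      have h1 : z - c * p ∈ Ideal.span {x} := by
        rw [← Ideal.Quotient.eq_zero_iff_mem]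
        change q (z - c * p) = 0
        rw [map_sub, map_mul, hc, sub_self]
      obtain ⟨d, hd⟩ := Ideal.mem_span_singleton'.1 h1
      have h2 : d ∈ P := by
        have : d * x ∈ P := by rw [hd]; exact P.sub_mem hz (P.mul_mem_left c hp)
        exact (hP.mem_or_mem this).resolve_right hx
      have h3 : z = c * p + x * d := by rw [mul_comm x, hd]; ring
      rw [h3]
      exact Submodule.add_mem_sup (Ideal.mem_span_singleton'.2 ⟨c, rfl⟩)
        (Ideal.mul_mem_mul (Ideal.mem_span_singleton_self _) h2)
  · exact (Ideal.span_singleton_le_iff_mem _).2 hp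

lemma prime_eq_max (S : Type) [CommRing S] [IsLocalRing S] (hS : IsRegularLocalTwoDim S)
    (g h : S) (hh0 : h ≠ 0) (hcop : ∀ p : S, Prime p → p ∣ g → ¬p ∣ h)
    (P : Ideal S) (hP : P.IsPrime) (hg : g ∈ P) (hh : h ∈ P) : P = maximalIdeal S := by
  obtain ⟨hN, -, x, y, hm⟩ := hS
  by_contra hne
  have hxy : x ∉ P ∨ y ∉ P := by
    by_contra! hc
    apply hne
    apply le_antisymm (IsLocalRing.le_maximalIdeal hP.ne_top)
    rw [hm, Ideal.span_le]
    rintro z (rfl | rfl)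
    exacts [hc.1, hc.2]
  have hpr : P.IsPrincipal := by
    rcases hxy with hx | hy
    · exact principal_of_ne S x y hm P hP hx
    · exact principal_of_ne S y x (by rw [hm, Set.pair_comm]) P hP hy
  obtain ⟨⟨p, hp⟩⟩ := hpr
  change P = Ideal.span {p} at hp
  subst hp
  have hp0 : p ≠ 0 := by
    rintro rfl
    exact hh0 (by simpa using hh)
  exact hcop p ((Ideal.span_singleton_prime hp0).1 hP) (Ideal.mem_span_singleton.1 hg)
    (Ideal.mem_span_singleton.1 hh)

lemma g_regular (S : Type) [CommRing S] [IsLocalRing S] (hS : IsRegularLocalTwoDim S)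
    (g h : S) (hh0 : h ≠ 0) (hcop : ∀ p : S, Prime p → p ∣ g → ¬p ∣ h)
    [IsLocalRing (S ⧸ Ideal.span {h})]
    (N : Type) [AddCommGroup N] [Module (S ⧸ Ideal.span {h}) N]
    (hNdepth : moduleDepth (S ⧸ Ideal.span {h}) N = 1)
    (z : N) (hz : Ideal.Quotient.mk (Ideal.span {h}) g • z = 0) : z = 0 := by
  have := hS.1
  by_contra hz0
  obtain ⟨P, hP, hle⟩ := exists_le_isAssociatedPrime_of_isNoetherianRing (S ⧸ Ideal.span {h}) z hz0
  have hgP : Ideal.Quotient.mk (Ideal.span {h}) g ∈ P := hle (by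
    rw [Submodule.mem_colon_singleton]; simpa using hz)
  have hprime := hP.isPrime
  have h1 := prime_eq_max S hS g h hh0 hcop (P.comap (Ideal.Quotient.mk _)) (hprime.comap _) hgP
    (by rw [Ideal.mem_comap, Ideal.Quotient.eq_zero_iff_mem.2 (Ideal.mem_span_singleton_self h)]
        exact P.zero_mem)
  have hPmax : P = maximalIdeal (S ⧸ Ideal.span {h}) := by
    apply IsLocalRing.eq_maximalIdeal
    have hmx : (P.comap (Ideal.Quotient.mk (Ideal.span {h}))).IsMaximal := by
      rw [h1]; infer_instance
    rw [← Ideal.map_comap_of_surjective _ Ideal.Quotient.mk_surjective P]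
    exact (Ideal.map_eq_top_or_isMaximal_of_surjective _ Ideal.Quotient.mk_surjective hmx).resolve_left
      (by rw [Ideal.map_comap_of_surjective _ Ideal.Quotient.mk_surjective P]; exact hprime.ne_top)
  obtain ⟨-, f, hf⟩ := (isAssociatedPrime_iff_exists_injective_linearMap _ _).1 hP
  subst hPmax
  have hnt : Nontrivial (ExtGroup (S ⧸ Ideal.span {h}) 0 (ResidueField (S ⧸ Ideal.span {h})) N) := by
    by_contra hc
    rw [not_nontrivial_iff_subsingleton] at hc
    let f' : ResidueField (S ⧸ Ideal.span {h}) →ₗ[S ⧸ Ideal.span {h}] N := f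
    have hf' : Function.Injective f' := hf
    have h0 := ext_zero_of _ _ _ hc (ModuleCat.ofHom f')
    have h00 : f' = 0 := by
      ext x
      exact LinearMap.congr_fun (congrArg ModuleCat.Hom.hom h0) x
    have : (1 : ResidueField (S ⧸ Ideal.span {h})) = 0 := hf' (by simp [h00])
    exact one_ne_zero this
  have hle0 : moduleDepth (S ⧸ Ideal.span {h}) N ≤ 0 := sInf_le ⟨0, rfl, hnt⟩
  rw [hNdepth] at hle0
  simp at hle0

/-- Let `S` be a `2`-dimensional complete regular local ring, `f = gh` with `g, h` having
no common prime factor and `gh` reduced, `R = S/(f)`, `T = S/(h)`.  For maximal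
Cohen-Macaulay `T`-modules `M, N` (viewed also as `R`-modules via the natural surjection
`R → T`), one has `Ext_R^1(M, N) = 0` if and only if `Ext_T^1(M, N) = 0`. -/
theorem ext_one_over_R_iff_ext_one_over_T
    (S : Type) [CommRing S] [IsLocalRing S] (hS : IsRegularLocalTwoDim S)
    (hcomp : IsAdicComplete (IsLocalRing.maximalIdeal S) S)
    (g h : S) (hg0 : g ≠ 0) (hh0 : h ≠ 0)
    (hcop : ∀ p : S, Prime p → p ∣ g → ¬p ∣ h)
    (hred : IsReduced (S ⧸ Ideal.span {g * h}))
    [IsLocalRing (S ⧸ Ideal.span {h})]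
    (M N : Type) [AddCommGroup M] [AddCommGroup N]
    [Module (S ⧸ Ideal.span {g * h}) M] [Module (S ⧸ Ideal.span {h}) M]
    [Module (S ⧸ Ideal.span {g * h}) N] [Module (S ⧸ Ideal.span {h}) N]
    (hMcompat : ∀ (s : S) (x : M),
      (Ideal.Quotient.mk (Ideal.span {g * h}) s) • x = (Ideal.Quotient.mk (Ideal.span {h}) s) • x)
    (hNcompat : ∀ (s : S) (x : N),
      (Ideal.Quotient.mk (Ideal.span {g * h}) s) • x = (Ideal.Quotient.mk (Ideal.span {h}) s) • x)
    (hMfin : Module.Finite (S ⧸ Ideal.span {h}) M)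
    (hNfin : Module.Finite (S ⧸ Ideal.span {h}) N)
    (hMdepth : moduleDepth (S ⧸ Ideal.span {h}) M = 1)
    (hNdepth : moduleDepth (S ⧸ Ideal.span {h}) N = 1) :
    Subsingleton (ExtGroup (S ⧸ Ideal.span {g * h}) 1 M N) ↔
      Subsingleton (ExtGroup (S ⧸ Ideal.span {h}) 1 M N) := by
  rw [ext_one_iff, ext_one_iff]
  have hreg := g_regular S hS g h hh0 hcop N hNdepth
  constructor
  · intro H Q _ _ i p hi hip hp
    letI : Module (S ⧸ Ideal.span {g * h}) Q := Module.compHom Q (Ideal.Quotient.factor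
      (show Ideal.span {g * h} ≤ Ideal.span {h} from
        Ideal.span_singleton_le_span_singleton.2 (Dvd.intro_left g rfl)))
    have hQ : ∀ (s : S) (x : Q), (Ideal.Quotient.mk (Ideal.span {g * h}) s) • x =
      (Ideal.Quotient.mk (Ideal.span {h}) s) • x := fun s x => rfl
    let i' : N →ₗ[S ⧸ Ideal.span {g * h}] Q :=
      { toFun := i
        map_add' := i.map_add
        map_smul' := fun r x => by
          obtain ⟨r, rfl⟩ := Ideal.Quotient.mk_surjective r
          rw [hNcompat, RingHom.id_apply, hQ, map_smul] }
    let p' : Q →ₗ[S ⧸ Ideal.span {g * h}] M :=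
      { toFun := p
        map_add' := p.map_add
        map_smul' := fun r x => by
          obtain ⟨r, rfl⟩ := Ideal.Quotient.mk_surjective r
          rw [RingHom.id_apply, hMcompat, hQ, map_smul] }
    obtain ⟨s, hs⟩ := H Q i' p' hi hip hp
    refine ⟨{ toFun := s, map_add' := s.map_add, map_smul' := fun r x => ?_ }, ?_⟩
    · obtain ⟨r, rfl⟩ := Ideal.Quotient.mk_surjective r
      rw [RingHom.id_apply, ← hMcompat, ← hQ, map_smul]
    · ext m
      exact LinearMap.congr_fun hs m
  · intro H Q _ _ i p hi hip hp
    letI : Module S Q := Module.compHom Q (Ideal.Quotient.mk (Ideal.span {g * h}))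
    have hSQ : ∀ (s : S) (x : Q), s • x = (Ideal.Quotient.mk (Ideal.span {g * h}) s) • x :=
      fun s x => rfl
    have hkill : ∀ x : Q, h • x = 0 := by
      intro x
      have h1 : p (h • x) = 0 := by
        rw [hSQ, map_smul, hMcompat,
          Ideal.Quotient.eq_zero_iff_mem.2 (Ideal.mem_span_singleton_self h), zero_smul]
      obtain ⟨n, hn⟩ := (hip _).1 h1
      have h2 : n = 0 := by
        apply hreg
        rw [← hNcompat]
        apply hi
        rw [map_smul, hn, map_zero, ← hSQ, smul_smul, hSQ,
          Ideal.Quotient.eq_zero_iff_mem.2 (Ideal.mem_span_singleton_self (g * h)), zero_smul]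
      rw [← hn, h2, map_zero]
    have htor : Module.IsTorsionBySet S Q (Ideal.span {h} : Ideal S) := by
      rintro x ⟨a, ha⟩
      obtain ⟨c, rfl⟩ := Ideal.mem_span_singleton'.1 ha
      change (c * h) • x = 0
      rw [mul_smul, hkill, smul_zero]
    letI : Module (S ⧸ Ideal.span {h}) Q := htor.module
    have hQ : ∀ (s : S) (x : Q), (Ideal.Quotient.mk (Ideal.span {g * h}) s) • x =
      (Ideal.Quotient.mk (Ideal.span {h}) s) • x := fun s x => rfl
    let i' : N →ₗ[S ⧸ Ideal.span {h}] Q :=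
      { toFun := i
        map_add' := i.map_add
        map_smul' := fun r x => by
          obtain ⟨r, rfl⟩ := Ideal.Quotient.mk_surjective r
          rw [← hNcompat, RingHom.id_apply, ← hQ, map_smul] }
    let p' : Q →ₗ[S ⧸ Ideal.span {h}] M :=
      { toFun := p
        map_add' := p.map_add
        map_smul' := fun r x => by
          obtain ⟨r, rfl⟩ := Ideal.Quotient.mk_surjective r
          rw [RingHom.id_apply, ← hMcompat, ← hQ, map_smul] }
    obtain ⟨s, hs⟩ := H Q i' p' hi hip hp
    refine ⟨{ toFun := s, map_add' := s.map_add, map_smul' := fun r x => ?_ }, ?_⟩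
    · obtain ⟨r, rfl⟩ := Ideal.Quotient.mk_surjective r
      rw [RingHom.id_apply, hMcompat, hQ, map_smul]
    · ext m
      exact LinearMap.congr_fun hs m
end

section
/- Let R be a Cohen-Macaulay local ring that is Gorenstein in codimension one, with dim R = d ≥ 2, and let M be a torsion-free R-module with pushforward exact sequence 0 → M → R^λ → M_1 → 0. Then for every prime p, M_p is free over R_p if and only if (M_1)_p is free over R_p. -/
open CategoryTheory Opposite IsLocalRing

def IsCohenMacaulayLocalRing (R : Type) [CommRing R] [IsLocalRing R] : Prop :=
  IsNoetherianRing R ∧ ((moduleDepth R R : ℕ∞) : WithBot ℕ∞) = ringKrullDim R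

/-- `ω` is a canonical (dualizing) module: finitely generated, with `Ext^i(k, ω)` zero away
from `i = dim R` and isomorphic to the residue field at `i = dim R`. -/
def IsCanonicalModule (R : Type) [CommRing R] [IsLocalRing R]
    (ω : Type) [AddCommGroup ω] [Module R ω] : Prop :=
  Module.Finite R ω ∧
    (∀ i : ℕ, ((i : ℕ∞) : WithBot ℕ∞) ≠ ringKrullDim R →
      Subsingleton (ExtGroup R i (ResidueField R) ω)) ∧
    (∀ i : ℕ, ((i : ℕ∞) : WithBot ℕ∞) = ringKrullDim R →
      Nonempty (ExtGroup R i (ResidueField R) ω ≃ₗ[R] ResidueField R))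

/-- A Gorenstein local ring: a Noetherian local ring which is a canonical module over
itself. -/
def IsGorensteinLocalRing (R : Type) [CommRing R] [IsLocalRing R] : Prop :=
  IsNoetherianRing R ∧ IsCanonicalModule R R

theorem ext_subsingleton_iff (R : Type) [CommRing R] (K : ModuleCat.{0} R)
    (P : ProjectiveResolution K) (N : ModuleCat.{0} R) (i : ℕ) :
    Subsingleton (((Ext R (ModuleCat R) i).obj (op K)).obj N) ↔
      ∀ f : P.complex.X i ⟶ N, P.complex.d (i+1) i ≫ f = 0 →
        ∃ g : P.complex.X ((ComplexShape.up ℕ).prev i) ⟶ N, P.complex.d i _ ≫ g = f := by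
  have h1 : Subsingleton (((Ext R (ModuleCat R) i).obj (op K)).obj N) ↔
      Limits.IsZero (((Ext R (ModuleCat R) i).obj (op K)).obj N) :=
    (ModuleCat.isZero_iff_subsingleton).symm
  rw [h1, (P.isoExt i N).isZero_iff, ← HomologicalComplex.exactAt_iff_isZero_homology,
    HomologicalComplex.exactAt_iff' _ _ i (i+1) rfl (by simp), ShortComplex.moduleCat_exact_iff]
  rfl

theorem ext_les (R : Type) [CommRing R] (K : ModuleCat.{0} R)
    (S : ShortComplex (ModuleCat.{0} R)) (hS : S.ShortExact) (i : ℕ)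
    (h2 : Subsingleton (((Ext R (ModuleCat R) i).obj (op K)).obj S.X₂))
    (h1 : Subsingleton (((Ext R (ModuleCat R) (i+1)).obj (op K)).obj S.X₁)) :
    Subsingleton (((Ext R (ModuleCat R) i).obj (op K)).obj S.X₃) := by
  let P := projectiveResolution K
  have := hS.mono_f
  have := hS.epi_g
  rw [ext_subsingleton_iff R K P] at *
  intro f hf
  have hproj : Projective (P.complex.X i) := P.projective i
  let f' := Projective.factorThru f S.g
  have hf' : f' ≫ S.g = f := Projective.factorThru_comp f S.g
  obtain ⟨g1, hg1⟩ := hS.exact.lift' (P.complex.d (i+1) i ≫ f') (by rw [Category.assoc, hf', hf])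
  obtain ⟨h, hh⟩ := h1 g1 (by
    rw [← cancel_mono S.f, Category.assoc, hg1]; simp)
  generalize hj : (ComplexShape.up ℕ).prev (i+1) = j at h hh
  have : j = i := by rw [← hj]; simp
  subst this
  obtain ⟨e, he⟩ := h2 (f' - h ≫ S.f) (by
    rw [Preadditive.comp_sub, ← hg1, ← hh, Category.assoc, sub_self])
  refine ⟨e ≫ S.g, ?_⟩
  rw [← Category.assoc, he]
  simp [hf']

theorem ext_one_extend (A : Type) [CommRing A] [IsLocalRing A]
    (h : Subsingleton (ExtGroup A 1 (ResidueField A) A)) (φ : maximalIdeal A →ₗ[A] A) :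
    ∃ c : A, ∀ r : maximalIdeal A, φ r = r.1 * c := by
  let K := ModuleCat.of A (ResidueField A)
  let P := projectiveResolution K
  rw [ExtGroup, ext_subsingleton_iff A K P] at h
  let ε : P.complex.X 0 ⟶ K := P.π.f 0 ≫ (HomologicalComplex.singleObjXSelf (ComplexShape.down ℕ) 0 K).hom
  have hε : Function.Surjective ε.hom := by
    rw [← ModuleCat.epi_iff_surjective]
    infer_instance
  have hdε : P.complex.d 1 0 ≫ ε = 0 := by
    rw [← Category.assoc, P.complex_d_comp_π_f_zero, Limits.zero_comp]
  have hex : ∀ z, ε.hom z = 0 → ∃ w, (P.complex.d 1 0).hom w = z := by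
    have := P.exact₀
    rw [ShortComplex.moduleCat_exact_iff] at this
    intro z hz
    refine this z ?_
    apply (ModuleCat.mono_iff_injective (HomologicalComplex.singleObjXSelf (ComplexShape.down ℕ) 0 K).hom).1 inferInstance
    rw [map_zero]
    exact hz
  have hproj : Projective (P.complex.X 0) := P.projective 0
  let π : ModuleCat.of A A ⟶ K := ModuleCat.ofHom (Algebra.linearMap A (ResidueField A))
  have : Epi π := by
    rw [ModuleCat.epi_iff_surjective]; exact residue_surjective
  let a := (Projective.factorThru ε π)
  have ha : a ≫ π = ε := Projective.factorThru_comp ε π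
  have ha' (z) : residue A (a.hom z) = ε.hom z := by rw [← ha]; rfl
  have hmem (w : P.complex.X 1) : a.hom ((P.complex.d 1 0).hom w) ∈ maximalIdeal A := by
    rw [← residue_eq_zero_iff, ha']
    exact congrArg (fun f => f.hom w) hdε
  let b : P.complex.X 1 ⟶ ModuleCat.of A (maximalIdeal A) :=
    ModuleCat.ofHom ((a.hom ∘ₗ (P.complex.d 1 0).hom).codRestrict (maximalIdeal A) hmem)
  obtain ⟨g, hg⟩ := h (b ≫ ModuleCat.ofHom φ) (by
    ext w
    have : (P.complex.d 1 0).hom ((P.complex.d 2 1).hom w) = 0 :=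
      congrArg (fun f => f.hom w) (P.complex.d_comp_d 2 1 0)
    change φ (b.hom ((P.complex.d 2 1).hom w)) = 0
    have hb : b.hom ((P.complex.d 2 1).hom w) = 0 := by
      apply Subtype.ext
      change a.hom ((P.complex.d 1 0).hom ((P.complex.d 2 1).hom w)) = 0
      rw [this, map_zero]
    rw [hb, map_zero])
  generalize hj : (ComplexShape.up ℕ).prev 1 = j at g hg
  have : j = 0 := by rw [← hj]; simp
  subst this
  obtain ⟨p0, hp0⟩ := hε (1 : ResidueField A)
  have hu : 1 - a.hom p0 ∈ maximalIdeal A := by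
    rw [← residue_eq_zero_iff, map_sub, ha', hp0, map_one, sub_self]
  refine ⟨g.hom p0 + φ ⟨_, hu⟩, fun r => ?_⟩
  obtain ⟨w, hw⟩ := hex (r.1 • p0) (by
    rw [map_smul, hp0, Algebra.smul_def, mul_one]
    exact (residue_eq_zero_iff _).2 r.2)
  have e1 : φ (b.hom w) = r.1 * g.hom p0 := by
    have := congrArg (fun f => f.hom w) hg
    change g.hom ((P.complex.d 1 0).hom w) = φ (b.hom w) at this
    rw [← this, hw, map_smul, smul_eq_mul]
  have e2 : r = b.hom w + r.1 • (⟨_, hu⟩ : maximalIdeal A) := by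
    apply Subtype.ext
    change r.1 = a.hom ((P.complex.d 1 0).hom w) + r.1 * (1 - a.hom p0)
    rw [hw, map_smul, smul_eq_mul]; ring
  conv_lhs => rw [e2]
  rw [map_add, map_smul, e1, smul_eq_mul]; ring

theorem ext_zero_nontrivial (R : Type) [CommRing R] [IsLocalRing R]
    (N : Type) [AddCommGroup N] [Module R N] (ψ : ResidueField R →ₗ[R] N)
    (hψ : ψ ≠ 0) : Nontrivial (ExtGroup R 0 (ResidueField R) N) := by
  by_contra hnt
  rw [not_nontrivial_iff_subsingleton] at hnt
  let K := ModuleCat.of R (ResidueField R)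
  let P := projectiveResolution K
  rw [ExtGroup, ext_subsingleton_iff R K P] at hnt
  let ε : P.complex.X 0 ⟶ K := P.π.f 0 ≫ (HomologicalComplex.singleObjXSelf (ComplexShape.down ℕ) 0 K).hom
  have hε : Epi ε := inferInstance
  have hdε : P.complex.d 1 0 ≫ ε = 0 := by
    rw [← Category.assoc, P.complex_d_comp_π_f_zero, Limits.zero_comp]
  obtain ⟨g, hg⟩ := hnt (ε ≫ ModuleCat.ofHom ψ) (by rw [← Category.assoc, hdε, Limits.zero_comp])
  rw [P.complex.shape _ _ (by simp), Limits.zero_comp] at hg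
  have h0 : ModuleCat.ofHom ψ = 0 := by
    rw [← cancel_epi ε, ← hg, Limits.comp_zero]
  apply hψ
  exact congrArg (fun f => f.hom) h0

open Pointwise in
theorem exists_assoc_quot (R : Type) [CommRing R] [IsLocalRing R] [IsNoetherianRing R]
    (N : Type) [AddCommGroup N] [Module R N] [Module.Finite R N] (p : Ideal R)
    (hp : IsAssociatedPrime p N) (x : R) (hx : x ∈ maximalIdeal R) (hreg : IsSMulRegular N x) :
    ∃ q : Ideal R, IsAssociatedPrime q (QuotSMulTop x N) ∧ p ≤ q ∧ x ∈ q := by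
  rw [isAssociatedPrime_iff] at hp
  obtain ⟨hpp, y, hy⟩ := hp
  let N' : Submodule R N :=
    { carrier := {n | ∀ a ∈ p, a • n = 0}
      add_mem' := fun {a b} ha hb c hc => by rw [smul_add, ha c hc, hb c hc, add_zero]
      zero_mem' := fun c _ => smul_zero c
      smul_mem' := fun r n hn c hc => by rw [smul_comm, hn c hc, smul_zero] }
  have hyN : y ∈ N' := fun a ha => by
    rw [hy, Submodule.mem_colon_singleton] at ha
    exact ha
  have hy0 : y ≠ 0 := by
    rintro rfl
    apply hpp.ne_top
    rw [hy]; simp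
  have hz : ∃ z ∈ N', z ∉ (x • ⊤ : Submodule R N) := by
    by_contra! hcon
    have : N' = ⊥ := by
      apply Submodule.eq_bot_of_le_smul_of_le_jacobson_bot (maximalIdeal R) N'
        (IsNoetherian.noetherian _)
      · intro z hz
        obtain ⟨n, -, rfl⟩ := hcon z hz
        refine Submodule.smul_mem_smul hx (fun a ha => ?_)
        apply hreg
        have := hz a ha
        simp only [DistribSMul.toLinearMap_apply] at this
        simp only [smul_zero]
        rw [smul_comm]; exact this
      · exact (IsLocalRing.jacobson_eq_maximalIdeal ⊥ bot_ne_top).ge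
    rw [this] at hyN
    exact hy0 hyN
  obtain ⟨z, hzN, hzx⟩ := hz
  obtain ⟨q, hq, hle⟩ := exists_le_isAssociatedPrime_of_isNoetherianRing R
    (Submodule.Quotient.mk z : QuotSMulTop x N)
    (by rwa [Ne, Submodule.Quotient.mk_eq_zero])
  refine ⟨q, hq, fun a ha => hle ?_, hle ?_⟩
  · rw [Submodule.mem_colon_singleton, ← Submodule.Quotient.mk_smul, hzN a ha]
    simp
  · rw [Submodule.mem_colon_singleton, ← Submodule.Quotient.mk_smul, Submodule.mem_bot,
      Submodule.Quotient.mk_eq_zero]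
    exact Submodule.smul_mem_pointwise_smul _ _ _ trivial

theorem exists_ext_nontrivial (R : Type) [CommRing R] [IsLocalRing R] [IsNoetherianRing R]
    (n : ℕ) : ∀ (N : Type) [AddCommGroup N] [Module R N] [Module.Finite R N]
    (p : PrimeSpectrum R) (_ : IsAssociatedPrime p.asIdeal N) (_ : Order.coheight p ≤ n),
    ∃ i ≤ n, Nontrivial (ExtGroup R i (ResidueField R) N) := by
  induction n with
  | zero =>
    intro N _ _ _ p hp hc
    have hpm : p.asIdeal = maximalIdeal R := by
      have h1 : IsMax p := by
        rw [← Order.coheight_eq_zero]; simpa using hc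
      have h2 : p ≤ closedPoint R := le_maximalIdeal p.2.ne_top
      exact congrArg PrimeSpectrum.asIdeal (h1.eq_of_le h2)
    rw [hpm, isAssociatedPrime_iff_exists_injective_linearMap] at hp
    obtain ⟨-, f, hf⟩ := hp
    refine ⟨0, le_rfl, ext_zero_nontrivial R N f ?_⟩
    intro h0
    have : (1 : ResidueField R) = 0 := hf (by rw [h0]; rfl)
    exact one_ne_zero this
  | succ n ih =>
    intro N _ _ _ p hp hc
    by_cases hm : IsAssociatedPrime (maximalIdeal R) N
    · rw [isAssociatedPrime_iff_exists_injective_linearMap] at hm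
      obtain ⟨-, f, hf⟩ := hm
      refine ⟨0, Nat.zero_le _, ext_zero_nontrivial R N f ?_⟩
      intro h0
      have : (1 : ResidueField R) = 0 := hf (by rw [h0]; rfl)
      exact one_ne_zero this
    · have hx : ∃ x ∈ maximalIdeal R, IsSMulRegular N x := by
        by_contra! hcon
        have hsub : (maximalIdeal R : Set R) ⊆ ⋃ q ∈ associatedPrimes R N, q := by
          rw [biUnion_associatedPrimes_eq_compl_regular]
          intro x hx; exact hcon x hx
        obtain ⟨q, hq, hle⟩ := (Ideal.subset_union_prime_finite (associatedPrimes.finite R N)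
          (f := id) 0 0 (fun _ h _ _ => h.isPrime)).1 hsub
        have : maximalIdeal R = q := (maximalIdeal.isMaximal R).eq_of_le hq.isPrime.ne_top hle
        exact hm (this ▸ hq)
      obtain ⟨x, hxm, hreg⟩ := hx
      obtain ⟨q, hq, hpq, hxq⟩ := exists_assoc_quot R N p.asIdeal hp x hxm hreg
      have hlt : p < (⟨q, hq.isPrime⟩ : PrimeSpectrum R) := by
        refine lt_of_le_of_ne hpq ?_
        rintro rfl
        have : x ∈ ⋃ q ∈ associatedPrimes R N, (q : Set R) := Set.mem_iUnion₂_of_mem hp hxq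
        rw [biUnion_associatedPrimes_eq_compl_regular] at this
        exact this hreg
      have hc2 : Order.coheight (⟨q, hq.isPrime⟩ : PrimeSpectrum R) ≤ n := by
        have := (Order.coheight_add_one_le hlt).trans hc
        push_cast at this
        exact (ENat.add_le_add_iff_right ENat.one_ne_top).1 this
      obtain ⟨i, hi, hnt⟩ := ih (QuotSMulTop x N) ⟨q, hq.isPrime⟩ hq hc2
      by_contra! hcon
      have h1 := hcon i (by omega)
      have h2 := hcon (i+1) (by omega)
      have := ext_les R (ModuleCat.of R (ResidueField R))
        ((ModuleCat.of R N).smulShortComplex x) (IsSMulRegular.smulShortComplex_shortExact hreg) i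
        h1 h2
      exact not_nontrivial_iff_subsingleton.2 this hnt

theorem height_eq_zero_of_assoc (R : Type) [CommRing R] [IsLocalRing R] [IsNoetherianRing R]
    (hd : ((moduleDepth R R : ℕ∞) : WithBot ℕ∞) = ringKrullDim R)
    (p : Ideal R) [hpp : p.IsPrime] (hp : IsAssociatedPrime p R) :
    ringKrullDim (Localization.AtPrime p) = 0 := by
  let P : PrimeSpectrum R := ⟨p, hpp⟩
  have h1 : Order.height P + Order.coheight P ≤ moduleDepth R R := by
    rw [← WithBot.coe_le_coe, hd, ringKrullDim, Order.krullDim_eq_iSup_height_add_coheight_of_nonempty,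
      WithBot.coe_le_coe]
    exact le_iSup (fun a : PrimeSpectrum R => Order.height a + Order.coheight a) P
  have hfin : moduleDepth R R ≠ ⊤ := by
    intro h
    rw [h] at hd
    have := ringKrullDim_lt_top (R := R)
    rw [← hd] at this
    exact lt_irrefl _ this
  have hc : Order.coheight P ≠ ⊤ := fun h => hfin (by
    rw [h] at h1; simpa using h1)
  obtain ⟨n, hn⟩ := ENat.ne_top_iff_exists.1 hc
  obtain ⟨i, hi, hnt⟩ := exists_ext_nontrivial R n R P hp hn.ge
  have h2 : moduleDepth R R ≤ Order.coheight P := by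
    rw [← hn]
    have h5 : moduleDepth R R ≤ (i : ℕ∞) := sInf_le ⟨i, rfl, hnt⟩
    exact h5.trans (by exact_mod_cast hi)
  have h3 : Order.height P = 0 := by
    have h4 := h1.trans h2
    have : Order.height P + Order.coheight P ≤ 0 + Order.coheight P := by simpa using h4
    exact le_antisymm ((ENat.add_le_add_iff_right hc).1 this) bot_le
  have h6 : p.height = 0 := by rw [← h3]; exact PrimeSpectrum.height_eq_orderHeight P
  rw [IsLocalization.AtPrime.ringKrullDim_eq_height p, h6]
  rfl

theorem exists_functional (A : Type) [CommRing A] [IsLocalRing A] [IsNoetherianRing A]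
    (hprime : ∀ q : Ideal A, q.IsPrime → q = maximalIdeal A)
    (h : Subsingleton (ExtGroup A 1 (ResidueField A) A))
    (N : Type) [AddCommGroup N] [Module A N] [Module.Finite A N] (x : N) (hx : x ≠ 0) :
    ∃ f : N →ₗ[A] A, f x ≠ 0 := by
  have hsoc (L : Type) [AddCommGroup L] [Module A L] [Nontrivial L] :
      ∃ y : L, y ≠ 0 ∧ ∀ r ∈ maximalIdeal A, r • y = 0 := by
    obtain ⟨q, hq⟩ := associatedPrimes.nonempty A L
    have hq' := isAssociatedPrime_iff.1 hq
    obtain ⟨hqp, y, hy⟩ := hq'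
    refine ⟨y, ?_, ?_⟩
    · rintro rfl
      apply hqp.ne_top; rw [hy]; simp
    · intro r hr
      rw [← hprime q hqp, hy, Submodule.mem_colon_singleton] at hr
      exact hr
  have hunit (L : Type) [AddCommGroup L] [Module A L] (D : Submodule A L) (y : L) (hy : y ∉ D)
      (r : A) (hr : r • y ∈ D) : r ∈ maximalIdeal A := by
    rw [mem_maximalIdeal]
    intro hu
    apply hy
    exact (Submodule.smul_mem_iff_of_isUnit D hu).1 hr
  obtain ⟨c, hc0, hc⟩ := hsoc A
  let φ : N →ₗ.[A] A := LinearPMap.mkSpanSingleton' x c (fun r hr => by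
    simpa using hc r (hunit N ⊥ x (by simpa using hx) r (by simpa using hr)))
  let T : Set (Submodule A N) := {D | ∃ ψ : N →ₗ.[A] A, φ ≤ ψ ∧ ψ.domain = D}
  obtain ⟨D, ⟨ψ, hφψ, rfl⟩, hmax⟩ := set_has_maximal_iff_noetherian.mpr
    (inferInstance : IsNoetherian A N) T ⟨_, φ, le_rfl, rfl⟩
  have htop : ψ.domain = ⊤ := by
    by_contra hne
    have : Nontrivial (N ⧸ ψ.domain) := Submodule.Quotient.nontrivial_iff.2 hne
    obtain ⟨y', hy0, hym⟩ := hsoc (N ⧸ ψ.domain)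
    obtain ⟨y, rfl⟩ := Submodule.Quotient.mk_surjective _ y'
    rw [Ne, Submodule.Quotient.mk_eq_zero] at hy0
    have hym' (r) (hr : r ∈ maximalIdeal A) : r • y ∈ ψ.domain := by
      have := hym r hr
      rwa [← Submodule.Quotient.mk_smul, Submodule.Quotient.mk_eq_zero] at this
    let θ : maximalIdeal A →ₗ[A] A :=
      ψ.toFun ∘ₗ (((LinearMap.toSpanSingleton A N y).comp (maximalIdeal A).subtype).codRestrict
        ψ.domain (fun r => hym' r.1 r.2))
    obtain ⟨e, he⟩ := ext_one_extend A h θ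
    have he' (r) (hr : r ∈ maximalIdeal A) : ψ ⟨r • y, hym' r hr⟩ = r * e := he ⟨r, hr⟩
    let χ : N →ₗ.[A] A := LinearPMap.mkSpanSingleton' y e (fun r hr => by
      have hrm := hunit N ψ.domain y hy0 r (by rw [hr]; exact zero_mem _)
      have := he' r hrm
      simp only [RingHom.id_apply, smul_eq_mul]
      rw [← this]
      have hz : (⟨r • y, hym' r hrm⟩ : ψ.domain) = 0 := Subtype.ext hr
      rw [hz, LinearPMap.map_zero])
    have hcompat : ∀ (u : ψ.domain) (v : χ.domain), (u : N) = v → ψ u = χ v := by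
      rintro ⟨u, hu⟩ ⟨v, hv⟩ (rfl : u = v)
      obtain ⟨r, rfl⟩ := Submodule.mem_span_singleton.1 hv
      rw [he' r (hunit N ψ.domain y hy0 r hu), LinearPMap.mkSpanSingleton'_apply]
      rfl
    apply hmax _ ⟨ψ.sup χ hcompat, hφψ.trans (LinearPMap.left_le_sup _ _ _), rfl⟩
    rw [LinearPMap.domain_sup]
    refine lt_of_le_of_ne le_sup_left (fun heq => hy0 ?_)
    rw [heq]
    exact Submodule.mem_sup_right (Submodule.mem_span_singleton_self y)
  refine ⟨ψ.toFun ∘ₗ LinearMap.id.codRestrict ψ.domain (fun n => by rw [htop]; trivial), ?_⟩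
  have hxφ : x ∈ φ.domain := Submodule.mem_span_singleton_self x
  have h1 : φ ⟨x, hxφ⟩ = ψ ⟨x, by rw [htop]; trivial⟩ := hφψ.2 rfl
  have h2 : φ ⟨x, hxφ⟩ = c := LinearPMap.mkSpanSingleton'_apply_self _ _ _ _
  intro h3
  apply hc0
  rw [← h2, h1]
  exact h3

theorem pushforward_functional_eq (R : Type) [CommRing R] (M : Type) [AddCommGroup M] [Module R M]
    (l : ℕ) (p : (Fin l → R) →ₗ[R] (M →ₗ[R] R)) (v : Fin l → R) (x : M) :
    p v x = ∑ i, v i * p (Pi.single i 1) x := by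
  conv_lhs => rw [← LinearMap.sum_single_apply (fun _ => R) v]
  rw [map_sum, LinearMap.sum_apply]
  refine Finset.sum_congr rfl (fun i _ => ?_)
  have : Pi.single i (v i) = v i • (Pi.single i 1 : Fin l → R) := by
    rw [← Pi.single_smul, smul_eq_mul, mul_one]
  simp [this]

theorem pushforward_injective
    (R : Type) [CommRing R] [IsLocalRing R] (hCM : IsCohenMacaulayLocalRing R)
    (hGor : ∀ (p : Ideal R) [p.IsPrime], ringKrullDim (Localization.AtPrime p) ≤ 1 →
      IsGorensteinLocalRing (Localization.AtPrime p))
    (M : Type) [AddCommGroup M] [Module R M] [Module.Finite R M]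
    (htf : Submodule.torsion R M = ⊥)
    (l : ℕ) (p : (Fin l → R) →ₗ[R] (M →ₗ[R] R))
    (hp : Function.Surjective p)
    (ι : M →ₗ[R] (Fin l → R))
    (hι : ι = LinearMap.pi (fun i => p (Pi.single i 1))) : Function.Injective ι := by
  have : IsNoetherianRing R := hCM.1
  have : Module.FinitePresentation R M := Module.finitePresentation_of_finite R M
  rw [injective_iff_map_eq_zero]
  intro x hx
  by_contra hx0
  have hsub : (((⊥ : Submodule R M).colon {x} : Ideal R) : Set R) ⊆
      ⋃ q ∈ associatedPrimes R R, q := by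
    rw [biUnion_associatedPrimes_eq_compl_nonZeroDivisors]
    intro r hr hnz
    rw [SetLike.mem_coe, Submodule.mem_colon_singleton] at hr
    apply hx0
    have : x ∈ Submodule.torsion R M := by
      rw [Submodule.mem_torsion_iff]
      exact ⟨⟨r, hnz⟩, hr⟩
    rwa [htf] at this
  obtain ⟨q, hq, hle⟩ := (Ideal.subset_union_prime_finite (associatedPrimes.finite R R)
    (f := id) 0 0 (fun _ h _ _ => h.isPrime)).1 hsub
  have hqp : q.IsPrime := hq.isPrime
  have hdim := height_eq_zero_of_assoc R hCM.2 q hq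
  have hG := hGor q (by rw [hdim]; exact zero_le_one)
  have hN : IsNoetherianRing (Localization.AtPrime q) := hG.1
  have hE := hG.2.2.1 1 (by rw [hdim]; simp)
  have hdim0 : Ring.KrullDimLE 0 (Localization.AtPrime q) := by
    rw [Ring.krullDimLE_iff, hdim]; rfl
  have hx1 : LocalizedModule.mkLinearMap q.primeCompl M x ≠ 0 := by
    intro h0
    obtain ⟨s, hs⟩ := (IsLocalizedModule.eq_zero_iff q.primeCompl
      (LocalizedModule.mkLinearMap q.primeCompl M)).1 h0
    exact s.2 (hle (by
      rw [Submodule.mem_colon_singleton]; exact hs))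
  obtain ⟨f, hf⟩ := exists_functional (Localization.AtPrime q)
    (fun Q hQ => (IsLocalRing.eq_maximalIdeal hQ.isMaximal')) hE
    (LocalizedModule q.primeCompl M) _ hx1
  obtain ⟨φ, s, hφ⟩ := Module.FinitePresentation.exists_lift_of_isLocalizedModule q.primeCompl
    (Algebra.linearMap R (Localization.AtPrime q))
    (f.restrictScalars R ∘ₗ LocalizedModule.mkLinearMap q.primeCompl M)
  obtain ⟨v, rfl⟩ := hp φ
  have h1 := LinearMap.congr_fun hφ x
  have h2 : p v x = 0 := by
    rw [pushforward_functional_eq]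
    refine Finset.sum_eq_zero (fun i _ => ?_)
    have : p (Pi.single i 1) x = ι x i := by rw [hι]; rfl
    rw [this, hx]; simp
  rw [LinearMap.comp_apply, h2, map_zero] at h1
  apply hf
  have h3 : algebraMap R (Localization.AtPrime q) s * f (LocalizedModule.mkLinearMap q.primeCompl M x) = 0 := by
    rw [← Algebra.smul_def]; exact h1.symm
  exact (IsLocalization.map_units (Localization.AtPrime q) s).mul_right_eq_zero.1 h3

theorem exists_retraction (A : Type) [CommRing A] (N B : Type) [AddCommGroup N] [Module A N]
    [AddCommGroup B] [Module A B] [Module.Finite A N] [Module.Free A N] (f : N →ₗ[A] B)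
    (h : ∀ e : N →ₗ[A] A, ∃ E : B →ₗ[A] A, E ∘ₗ f = e) : ∃ r : B →ₗ[A] N, r ∘ₗ f = LinearMap.id := by
  let b := Module.Free.chooseBasis A N
  choose E hE using h
  refine ⟨∑ j, (E (b.coord j)).smulRight (b j), ?_⟩
  refine LinearMap.ext fun x => ?_
  have hEj (j) : E (b.coord j) (f x) = b.coord j x := LinearMap.congr_fun (hE (b.coord j)) x
  simp only [LinearMap.comp_apply, LinearMap.sum_apply, LinearMap.smulRight_apply, hEj]
  exact b.sum_repr x

/-- Let `R` be a Cohen-Macaulay local ring, Gorenstein in codimension one, of dimension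
`d ≥ 2`, and `M` a finitely generated torsion-free module.  Form the pushforward
`0 → M → R^λ → M₁ → 0` by dualizing a minimal free cover `p : R^λ → M^*`.  Then for every
prime `p`, `M_p` is free over `R_p` iff `(M₁)_p` is free over `R_p`. -/
theorem pushforward_free_iff
    (R : Type) [CommRing R] [IsLocalRing R] (hCM : IsCohenMacaulayLocalRing R)
    (d : ℕ) (hd : 2 ≤ d) (hdim : ringKrullDim R = d)
    (hGor : ∀ (p : Ideal R) [p.IsPrime], ringKrullDim (Localization.AtPrime p) ≤ 1 →
      IsGorensteinLocalRing (Localization.AtPrime p))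
    (M : Type) [AddCommGroup M] [Module R M] [Module.Finite R M]
    (htf : Submodule.torsion R M = ⊥)
    (l : ℕ) (p : (Fin l → R) →ₗ[R] (M →ₗ[R] R))
    (hp : Function.Surjective p)
    (hpmin : LinearMap.ker p ≤ (IsLocalRing.maximalIdeal R) • ⊤)
    -- the canonical map `M → R^λ` obtained by dualizing `p` (using `M ↪ M^**`)
    (ι : M →ₗ[R] (Fin l → R))
    (hι : ι = LinearMap.pi (fun i => p (Pi.single i 1)))
    (q : Ideal R) [q.IsPrime] :
    Module.Free (Localization.AtPrime q) (LocalizedModule q.primeCompl M) ↔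
      Module.Free (Localization.AtPrime q)
        (LocalizedModule q.primeCompl ((Fin l → R) ⧸ LinearMap.range ι)) := by
  have : IsNoetherianRing R := hCM.1
  have : Module.FinitePresentation R M := Module.finitePresentation_of_finite R M
  have hinj := pushforward_injective R hCM hGor M htf l p hp ι hι
  let f := LocalizedModule.map q.primeCompl ι
  let g := LocalizedModule.map q.primeCompl (LinearMap.range ι).mkQ
  have hf : Function.Injective f := LocalizedModule.map_injective q.primeCompl ι hinj
  have hg : Function.Surjective g :=
    LocalizedModule.map_surjective q.primeCompl _ (Submodule.mkQ_surjective _)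
  have hex : Function.Exact f g :=
    LocalizedModule.map_exact q.primeCompl ι _ (LinearMap.exact_map_mkQ_range ι)
  have hB : Module.Free (Localization.AtPrime q) (LocalizedModule q.primeCompl (Fin l → R)) :=
    Module.free_of_isLocalizedModule q.primeCompl
      (LocalizedModule.mkLinearMap q.primeCompl (Fin l → R))
  have tfae : (∃ t, g ∘ₗ t = LinearMap.id) ↔ (∃ r, r ∘ₗ f = LinearMap.id) :=
    (hex.split_tfae hf hg).out 0 1
  constructor
  · intro hfree
    obtain ⟨r, hr⟩ := exists_retraction (Localization.AtPrime q) _ _ f (by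
      intro e
      obtain ⟨φ, s, hφ⟩ := Module.FinitePresentation.exists_lift_of_isLocalizedModule q.primeCompl
        (Algebra.linearMap R (Localization.AtPrime q))
        (e.restrictScalars R ∘ₗ LocalizedModule.mkLinearMap q.primeCompl M)
      obtain ⟨v, rfl⟩ := hp φ
      let δ : (Fin l → R) →ₗ[R] R := ∑ i, v i • LinearMap.proj i
      have hδ (x : M) : δ (ι x) = p v x := by
        rw [pushforward_functional_eq, hι]
        simp [δ]
      let δ' := IsLocalizedModule.mapExtendScalars q.primeCompl
        (LocalizedModule.mkLinearMap q.primeCompl (Fin l → R))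
        (Algebra.linearMap R (Localization.AtPrime q)) (Localization.AtPrime q) δ
      have hδ' (w : Fin l → R) : δ' (LocalizedModule.mkLinearMap q.primeCompl (Fin l → R) w) =
          algebraMap R _ (δ w) :=
        IsLocalizedModule.map_apply q.primeCompl _ _ _ _
      refine ⟨IsLocalization.mk' (Localization.AtPrime q) 1 s • δ', ?_⟩
      apply LinearMap.restrictScalars_injective R
      apply IsLocalizedModule.linearMap_ext q.primeCompl
        (LocalizedModule.mkLinearMap q.primeCompl M) (Algebra.linearMap R (Localization.AtPrime q))
      ext x
      have h1 := LinearMap.congr_fun hφ x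
      have h2 : f (LocalizedModule.mkLinearMap q.primeCompl M x) =
        LocalizedModule.mkLinearMap q.primeCompl (Fin l → R) (ι x) := by
        simp [f]
      have h1' : algebraMap R (Localization.AtPrime q) (p v x) =
          algebraMap R _ s.1 * e (LocalizedModule.mkLinearMap q.primeCompl M x) := by
        rw [← Algebra.smul_def]; exact h1
      change IsLocalization.mk' (Localization.AtPrime q) 1 s *
        δ' (f (LocalizedModule.mkLinearMap q.primeCompl M x)) =
          e (LocalizedModule.mkLinearMap q.primeCompl M x)
      rw [h2, hδ', hδ, h1', ← mul_assoc, IsLocalization.mk'_spec, map_one, one_mul])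
    obtain ⟨t, ht⟩ := tfae.2 ⟨r, hr⟩
    have := Module.Projective.of_split t g ht
    exact Module.free_of_flat_of_isLocalRing
  · intro hfree
    obtain ⟨t, ht⟩ := Module.projective_lifting_property g LinearMap.id hg
    obtain ⟨r, hr⟩ := tfae.1 ⟨t, ht⟩
    have := Module.Projective.of_split f r hr
    exact Module.free_of_flat_of_isLocalRing
end
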